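/- Let (Ω, ℱ, μ) be a probability space, let A ⊆ Ω be a measurable event with 0 < μ(A) < 1, let f, p, q : Ω → ℝ be nonnegative integrable random variables, and let δ₁, δ₂ ≥ 0 be real constants such that ∫ p d(μ[·|A]) ≤ ∫ f d(μ[·|Aᶜ]) + δ₁ and ∫ q d(μ[·|Aᶜ]) ≥ ∫ f d(μ[·|A]) − δ₂. Then the total advantage of the test with and without poisoning is bounded by the total mapping error: ∫₀^∞ (μ[{ω : p(ω) ≥ γ} | A] + μ[{ω : q(ω) < γ} | Aᶜ] − 1) dγ + ∫₀^∞ (μ[{ω : f(ω) ≥ γ} | A] + μ[{ω : f(ω) < γ} | Aᶜ] − 1) dγ ≤ δ₁ + δ₂. -/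

import Mathlib

open MeasureTheory ProbabilityTheory

/-- The tail function of a nonnegative integrable function is integrable on `(0, ∞)`. -/
theorem integrableOn_measureReal_le {Ω : Type*} [MeasurableSpace Ω] {ν : Measure Ω} {g : Ω → ℝ}
    (hg : Integrable g ν) (hg_nonneg : 0 ≤ᵐ[ν] g) :
    IntegrableOn (fun γ : ℝ => ν.real {ω | γ ≤ g ω}) (Set.Ioi 0) := by
  have hanti : Antitone (fun γ : ℝ => ν {ω | γ ≤ g ω}) :=
    fun _ _ hst => measure_mono fun _ hω => hst.trans hω
  refine integrable_toReal_of_lintegral_ne_top hanti.measurable.aemeasurable ?_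
  rw [← lintegral_eq_lintegral_meas_le ν hg_nonneg hg.aemeasurable]
  exact hg.lintegral_lt_top.ne

/-- Integrating Youden's `J` statistic over all positive thresholds gives the difference of the
expectations. -/
theorem integral_measureReal_le_add_measureReal_lt_sub_one {Ω : Type*} [MeasurableSpace Ω]
    {ν ρ : Measure Ω} [IsProbabilityMeasure ρ] {g h : Ω → ℝ}
    (hg : Integrable g ν) (hg_nonneg : 0 ≤ᵐ[ν] g)
    (hh : Integrable h ρ) (hh_nonneg : 0 ≤ᵐ[ρ] h) :
    ∫ γ in Set.Ioi (0 : ℝ), (ν.real {ω | γ ≤ g ω} + ρ.real {ω | h ω < γ} - 1)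
      = ∫ ω, g ω ∂ν - ∫ ω, h ω ∂ρ := by
  rw [hg.integral_eq_integral_meas_le hg_nonneg, hh.integral_eq_integral_meas_le hh_nonneg,
    ← integral_sub (integrableOn_measureReal_le hg hg_nonneg)
      (integrableOn_measureReal_le hh hh_nonneg)]
  congr 1 with γ
  have hcompl : {ω | h ω < γ} = {ω | γ ≤ h ω}ᶜ := by ext; simp
  have hnull : NullMeasurableSet {ω | γ ≤ h ω} ρ :=
    nullMeasurableSet_le aemeasurable_const hh.aemeasurable
  rw [hcompl, probReal_compl_eq_one_sub₀ hnull]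
  ring

theorem integrable_cond {Ω : Type*} [MeasurableSpace Ω] {μ : Measure Ω} {s : Set Ω}
    {g : Ω → ℝ} (hs : μ s ≠ 0) (hg : Integrable g μ) : Integrable g (μ[|s]) :=
  hg.restrict.smul_measure (ENNReal.inv_ne_top.2 hs)

/-- Abstract content of Theorem 1 of the paper (trade-off of membership inference under
PoisonM): for a probability space `(Ω, ℱ, μ)`, a measurable event `A` with `0 < μ A < 1`,
nonnegative integrable scores `f p q : Ω → ℝ`, and constants `δ₁ δ₂ ≥ 0` with
`E[p | A] ≤ E[f | Aᶜ] + δ₁` and `E[q | Aᶜ] ≥ E[f | A] − δ₂`, the total advantage of the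
test with and without poisoning is bounded by the total mapping error:
`∫₀^∞ (μ[{p ≥ γ} | A] + μ[{q < γ} | Aᶜ] − 1) dγ
  + ∫₀^∞ (μ[{f ≥ γ} | A] + μ[{f < γ} | Aᶜ] − 1) dγ ≤ δ₁ + δ₂`. -/
theorem tradeoff_of_membership_inference_under_poisoning
    {Ω : Type*} [MeasurableSpace Ω] (μ : Measure Ω) [IsProbabilityMeasure μ]
    (A : Set Ω) (hA : MeasurableSet A) (hA0 : 0 < μ A) (hA1 : μ A < 1)
    (f p q : Ω → ℝ)
    (hf_nonneg : ∀ ω, 0 ≤ f ω) (hf_int : Integrable f μ)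
    (hp_nonneg : ∀ ω, 0 ≤ p ω) (hp_int : Integrable p μ)
    (hq_nonneg : ∀ ω, 0 ≤ q ω) (hq_int : Integrable q μ)
    (δ₁ δ₂ : ℝ) (hδ₁ : 0 ≤ δ₁) (hδ₂ : 0 ≤ δ₂)
    (h₁ : ∫ ω, p ω ∂(μ[|A]) ≤ ∫ ω, f ω ∂(μ[|Aᶜ]) + δ₁)
    (h₂ : ∫ ω, q ω ∂(μ[|Aᶜ]) ≥ ∫ ω, f ω ∂(μ[|A]) - δ₂) :
    (∫ γ in Set.Ioi (0 : ℝ),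
        ((μ[|A] {ω | p ω ≥ γ}).toReal + (μ[|Aᶜ] {ω | q ω < γ}).toReal - 1))
      + (∫ γ in Set.Ioi (0 : ℝ),
        ((μ[|A] {ω | f ω ≥ γ}).toReal + (μ[|Aᶜ] {ω | f ω < γ}).toReal - 1))
      ≤ δ₁ + δ₂ := by
  have hAc0 : μ Aᶜ ≠ 0 := by
    rw [prob_compl_eq_one_sub hA]
    exact (tsub_pos_of_lt hA1).ne'
  have := cond_isProbabilityMeasure hAc0
  have hpq := integral_measureReal_le_add_measureReal_lt_sub_one
    (integrable_cond hA0.ne' hp_int) (ae_of_all _ hp_nonneg)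
    (integrable_cond hAc0 hq_int) (ae_of_all _ hq_nonneg)
  have hff := integral_measureReal_le_add_measureReal_lt_sub_one
    (integrable_cond hA0.ne' hf_int) (ae_of_all _ hf_nonneg)
    (integrable_cond hAc0 hf_int) (ae_of_all _ hf_nonneg)
  simp only [measureReal_def] at hpq hff
  simp only [ge_iff_le] at h₂ ⊢
  rw [hpq, hff]
  linarith
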